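/- arXiv:1305.7345 — 13 statements merged into one kernel-verified Lean document; each statement's English description precedes it below -/
import Mathlib

section
/- Let φ : ι → Set (α × α) satisfy JEPD (each φ r is nonempty, the φ r are pairwise disjoint, and ⋃ r, φ r = Set.univ) and let conv : ι → Set ι satisfy the weak converse property: conv r = ⋂₀ {S : Set ι | Φ S ⊇ (φ r)⁻¹} for every r : ι. Then for every R : Set ι, R˘ = ⋂₀ {S : Set ι | Φ S ⊇ (Φ R)⁻¹}, where R˘ = ⋃ r ∈ R, conv r. -/
open Set

/-- Extension of an interpretation `φ` of base-relation names to sets of names. -/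
def interp {α ι : Type*} (φ : ι → Set (α × α)) (R : Set ι) : Set (α × α) :=
  ⋃ r ∈ R, φ r

/-- Converse of a binary relation, as a set of pairs. -/
def relConv {α : Type*} (E : Set (α × α)) : Set (α × α) :=
  {p | (p.2, p.1) ∈ E}

/-- For a partition `φ`, the least set of names whose extension covers `E` consists of the names
whose relations meet `E`. -/
theorem sInter_subset_interp {α ι : Type*} {φ : ι → Set (α × α)}
    (hdisj : ∀ r s : ι, r ≠ s → Disjoint (φ r) (φ s)) (hexh : ⋃ r : ι, φ r = Set.univ)
    (E : Set (α × α)) :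
    ⋂₀ {S : Set ι | E ⊆ interp φ S} = {s | (E ∩ φ s).Nonempty} := by
  apply Set.Subset.antisymm
  · refine Set.sInter_subset_of_mem fun p hp => ?_
    obtain ⟨s, hs⟩ := Set.mem_iUnion.1 (hexh.symm ▸ Set.mem_univ p)
    exact Set.mem_biUnion (show s ∈ {s | (E ∩ φ s).Nonempty} from ⟨p, hp, hs⟩) hs
  · rintro s ⟨p, hp, hps⟩ S hS
    obtain ⟨t, ht, hpt⟩ := Set.mem_iUnion₂.1 (hS hp)
    by_cases h : t = s
    · exact h ▸ ht
    · exact (Set.disjoint_left.1 (hdisj t s h) hpt hps).elim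

theorem weak_converse_lifts {α ι : Type*} (φ : ι → Set (α × α))
    (conv : ι → Set ι)
    (hne : ∀ r : ι, (φ r).Nonempty)
    (hdisj : ∀ r s : ι, r ≠ s → Disjoint (φ r) (φ s))
    (hexh : ⋃ r : ι, φ r = Set.univ)
    (hconv : ∀ r : ι, conv r = ⋂₀ {S : Set ι | relConv (φ r) ⊆ interp φ S}) :
    ∀ R : Set ι,
      (⋃ r ∈ R, conv r) = ⋂₀ {S : Set ι | relConv (interp φ R) ⊆ interp φ S} := by
  intro R
  simp only [hconv, sInter_subset_interp hdisj hexh]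
  ext s
  simp only [interp, relConv, Set.Nonempty, Set.mem_iUnion, Set.mem_ofPred_eq, Set.mem_inter_iff,
    exists_prop]
  constructor
  · rintro ⟨r, hr, p, hp, hs⟩
    exact ⟨p, ⟨r, hr, hp⟩, hs⟩
  · rintro ⟨p, ⟨r, hr, hp⟩, hs⟩
    exact ⟨r, hr, p, hp, hs⟩
end

section
/- Let φ : ι → Set (α × α) satisfy JEPD (each φ r is nonempty, the φ r are pairwise disjoint, and ⋃ r, φ r = Set.univ) and let comp : ι → ι → Set ι satisfy the weak composition property: comp r s = ⋂₀ {T : Set ι | Φ T ⊇ φ r ○ φ s} for all r s : ι. Then for all R S : Set ι, R ⋄ S = ⋂₀ {T : Set ι | Φ T ⊇ (Φ R) ○ (Φ S)}, where R ⋄ S = ⋃ r ∈ R, ⋃ s ∈ S, comp r s. -/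
open Set

/-- Composition of binary relations, as sets of pairs. -/
def relComp {α : Type*} (E F : Set (α × α)) : Set (α × α) :=
  {p | ∃ y, (p.1, y) ∈ E ∧ (y, p.2) ∈ F}

theorem relComp_mono {α : Type*} {E E' F F' : Set (α × α)} (hE : E ⊆ E') (hF : F ⊆ F') :
    relComp E F ⊆ relComp E' F' :=
  fun _ ⟨y, h₁, h₂⟩ => ⟨y, hE h₁, hF h₂⟩

theorem subset_interp {α ι : Type*} (φ : ι → Set (α × α)) {R : Set ι} {r : ι} (hr : r ∈ R) :
    φ r ⊆ interp φ R :=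
  Set.subset_biUnion_of_mem (u := φ) hr

/-- If the base relations partition the universe, every relation has a least covering by
base relations. -/
theorem subset_interp_sInter {α ι : Type*} {φ : ι → Set (α × α)}
    (hdisj : ∀ r s : ι, r ≠ s → Disjoint (φ r) (φ s))
    (hexh : ⋃ r : ι, φ r = Set.univ) (E : Set (α × α)) :
    E ⊆ interp φ (⋂₀ {T : Set ι | E ⊆ interp φ T}) := by
  intro p hp
  obtain ⟨t, ht⟩ := Set.mem_iUnion.1 (hexh ▸ Set.mem_univ p)
  refine subset_interp φ (r := t) (fun T hT => ?_) ht
  obtain ⟨u, hu, hpu⟩ := Set.mem_iUnion₂.1 (hT hp)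
  by_cases h : t = u
  · exact h ▸ hu
  · exact (Set.disjoint_left.1 (hdisj t u h) ht hpu).elim

theorem weak_composition_lifts {α ι : Type*} (φ : ι → Set (α × α))
    (comp : ι → ι → Set ι)
    (hne : ∀ r : ι, (φ r).Nonempty)
    (hdisj : ∀ r s : ι, r ≠ s → Disjoint (φ r) (φ s))
    (hexh : ⋃ r : ι, φ r = Set.univ)
    (hcomp : ∀ r s : ι, comp r s = ⋂₀ {T : Set ι | relComp (φ r) (φ s) ⊆ interp φ T}) :
    ∀ R S : Set ι,
      (⋃ r ∈ R, ⋃ s ∈ S, comp r s) =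
        ⋂₀ {T : Set ι | relComp (interp φ R) (interp φ S) ⊆ interp φ T} := by
  intro R S
  apply Set.Subset.antisymm
  · refine Set.iUnion₂_subset fun r hr => Set.iUnion₂_subset fun s hs => ?_
    rw [hcomp]
    exact Set.sInter_subset_sInter fun T hT =>
      (relComp_mono (subset_interp φ hr) (subset_interp φ hs)).trans hT
  · apply Set.sInter_subset_of_mem
    rintro p ⟨y, h₁, h₂⟩
    obtain ⟨r, hr, hpr⟩ := Set.mem_iUnion₂.1 h₁
    obtain ⟨s, hs, hps⟩ := Set.mem_iUnion₂.1 h₂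
    have hp := subset_interp_sInter hdisj hexh (relComp (φ r) (φ s)) ⟨y, hpr, hps⟩
    rw [← hcomp] at hp
    obtain ⟨t, ht, hpt⟩ := Set.mem_iUnion₂.1 hp
    exact subset_interp φ (Set.mem_iUnion₂.2 ⟨r, hr, Set.mem_iUnion₂.2 ⟨s, hs, ht⟩⟩) hpt
end

section
/- Let φ : ι → Set (α × α) satisfy JEPD (each φ r is nonempty, the φ r are pairwise disjoint, and ⋃ r, φ r = Set.univ) and let conv : ι → Set ι satisfy the abstract converse property: Φ (conv r) ⊇ (φ r)⁻¹ for every r : ι. Then one inclusion of the involution axiom (R7⊇) always holds: for every r : ι, r ∈ ⋃ s ∈ conv r, conv s (i.e., {r} ⊆ ({r}˘)˘). -/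
open Set

theorem R7_sup_always_holds {α ι : Type*} (φ : ι → Set (α × α))
    (conv : ι → Set ι)
    (hne : ∀ r : ι, (φ r).Nonempty)
    (hdisj : ∀ r s : ι, r ≠ s → Disjoint (φ r) (φ s))
    (hexh : ⋃ r : ι, φ r = Set.univ)
    (hconv : ∀ r : ι, relConv (φ r) ⊆ interp φ (conv r)) :
    ∀ r : ι, r ∈ ⋃ s ∈ conv r, conv s := by
  intro r
  obtain ⟨⟨x, y⟩, hxy⟩ := hne r
  obtain ⟨s, hs, hyx⟩ := mem_iUnion₂.1 (hconv r (show (y, x) ∈ relConv (φ r) from hxy))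
  obtain ⟨t, ht, hxy'⟩ := mem_iUnion₂.1 (hconv s (show (x, y) ∈ relConv (φ s) from hyx))
  have hrt : r = t := by
    by_contra h
    exact disjoint_left.1 (hdisj r t h) hxy hxy'
  exact mem_iUnion₂.2 ⟨s, hs, hrt ▸ ht⟩
end

section
/- Let φ : ι → Set (α × α) satisfy JEPD (each φ r is nonempty, the φ r are pairwise disjoint, and ⋃ r, φ r = Set.univ) and let comp : ι → ι → Set ι satisfy the abstract composition property: Φ (comp r s) ⊇ φ r ○ φ s for all r s : ι. Then one inclusion of semi-associativity (SA⊇) always holds: for every R : Set ι, R ⋄ 1 ⊆ (R ⋄ 1) ⋄ 1, where 1 denotes (Set.univ : Set ι) and R ⋄ S = ⋃ r ∈ R, ⋃ s ∈ S, comp r s. -/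
open Set

/-- Extension of a composition table to sets of base-relation names. -/
def setComp {ι : Type*} (comp : ι → ι → Set ι) (R S : Set ι) : Set ι :=
  ⋃ r ∈ R, ⋃ s ∈ S, comp r s

theorem SA_sup_always_holds {α ι : Type*} (φ : ι → Set (α × α))
    (comp : ι → ι → Set ι)
    (hne : ∀ r : ι, (φ r).Nonempty)
    (hdisj : ∀ r s : ι, r ≠ s → Disjoint (φ r) (φ s))
    (hexh : ⋃ r : ι, φ r = Set.univ)
    (hcomp : ∀ r s : ι, relComp (φ r) (φ s) ⊆ interp φ (comp r s)) :
    ∀ R : Set ι,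
      setComp comp R Set.univ ⊆ setComp comp (setComp comp R Set.univ) Set.univ := by
  intro R t ht
  obtain ⟨⟨x, z⟩, hxz⟩ := hne t
  obtain ⟨u, hu⟩ := mem_iUnion.1 (hexh.symm ▸ mem_univ (z, z) : (z, z) ∈ ⋃ r : ι, φ r)
  obtain ⟨v, hv, hxzv⟩ := mem_iUnion₂.1 (hcomp t u (show (x, z) ∈ relComp (φ t) (φ u) from ⟨z, hxz, hu⟩))
  obtain rfl : t = v := by
    by_contra hne'
    exact disjoint_left.1 (hdisj t v hne') hxz hxzv
  exact mem_iUnion₂.2 ⟨t, ht, mem_iUnion₂.2 ⟨u, mem_univ u, hv⟩⟩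
end

section
/- Let φ : ι → Set (α × α) satisfy JEPD (each φ r is nonempty, the φ r are pairwise disjoint, and ⋃ r, φ r = Set.univ) and let comp : ι → ι → Set ι satisfy the strong composition property: Φ (comp r s) = φ r ○ φ s for all r s : ι. Then composition is associative: for all R S T : Set ι, (R ⋄ S) ⋄ T = R ⋄ (S ⋄ T), where R ⋄ S = ⋃ r ∈ R, ⋃ s ∈ S, comp r s. -/
open Set

theorem relComp_assoc {α : Type*} (E F G : Set (α × α)) :
    relComp (relComp E F) G = relComp E (relComp F G) := by
  ext ⟨x, z⟩
  constructor
  · rintro ⟨y, ⟨w, hE, hF⟩, hG⟩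
    exact ⟨w, hE, y, hF, hG⟩
  · rintro ⟨w, hE, y, hF, hG⟩
    exact ⟨y, ⟨w, hE, hF⟩, hG⟩

theorem interp_injective {α ι : Type*} {φ : ι → Set (α × α)}
    (hne : ∀ r : ι, (φ r).Nonempty)
    (hdisj : ∀ r s : ι, r ≠ s → Disjoint (φ r) (φ s)) :
    Function.Injective (interp φ) := by
  have key : ∀ {R S : Set ι}, interp φ R ⊆ interp φ S → R ⊆ S := by
    intro R S h r hr
    obtain ⟨p, hp⟩ := hne r
    obtain ⟨s, hs, hps⟩ := mem_iUnion₂.1 (h (mem_iUnion₂.2 ⟨r, hr, hp⟩))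
    by_cases hrs : r = s
    · exact hrs ▸ hs
    · exact (disjoint_left.1 (hdisj r s hrs) hp hps).elim
  exact fun R S h => (key h.subset).antisymm (key h.superset)

theorem interp_setComp {α ι : Type*} {φ : ι → Set (α × α)} {comp : ι → ι → Set ι}
    (hcomp : ∀ r s : ι, interp φ (comp r s) = relComp (φ r) (φ s)) (R S : Set ι) :
    interp φ (setComp comp R S) = relComp (interp φ R) (interp φ S) := by
  ext ⟨x, z⟩
  constructor
  · intro h
    obtain ⟨t, ht, hxz⟩ := mem_iUnion₂.1 h
    obtain ⟨r, hr, ht⟩ := mem_iUnion₂.1 ht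
    obtain ⟨s, hs, ht⟩ := mem_iUnion₂.1 ht
    have hmem : (x, z) ∈ interp φ (comp r s) := mem_iUnion₂.2 ⟨t, ht, hxz⟩
    rw [hcomp] at hmem
    obtain ⟨y, hxy, hyz⟩ := hmem
    exact ⟨y, mem_iUnion₂.2 ⟨r, hr, hxy⟩, mem_iUnion₂.2 ⟨s, hs, hyz⟩⟩
  · rintro ⟨y, hxy, hyz⟩
    obtain ⟨r, hr, hxy⟩ := mem_iUnion₂.1 hxy
    obtain ⟨s, hs, hyz⟩ := mem_iUnion₂.1 hyz
    have hmem : (x, z) ∈ relComp (φ r) (φ s) := ⟨y, hxy, hyz⟩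
    rw [← hcomp] at hmem
    obtain ⟨t, ht, hxz⟩ := mem_iUnion₂.1 hmem
    exact mem_iUnion₂.2 ⟨t, mem_iUnion₂.2 ⟨r, hr, mem_iUnion₂.2 ⟨s, hs, ht⟩⟩, hxz⟩

theorem strong_composition_implies_R4 {α ι : Type*} (φ : ι → Set (α × α))
    (comp : ι → ι → Set ι)
    (hne : ∀ r : ι, (φ r).Nonempty)
    (hdisj : ∀ r s : ι, r ≠ s → Disjoint (φ r) (φ s))
    (hexh : ⋃ r : ι, φ r = Set.univ)
    (hcomp : ∀ r s : ι, interp φ (comp r s) = relComp (φ r) (φ s)) :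
    ∀ R S T : Set ι,
      setComp comp (setComp comp R S) T = setComp comp R (setComp comp S T) := by
  intro R S T
  apply interp_injective hne hdisj
  simp only [interp_setComp hcomp, relComp_assoc]
end

section
/- Let φ : ι → Set (α × α) satisfy JEPD (each φ r is nonempty, the φ r are pairwise disjoint, and ⋃ r, φ r = Set.univ) and let conv : ι → Set ι satisfy the abstract converse property: Φ (conv r) ⊇ (φ r)⁻¹ for every r : ι. Then the following are equivalent: (1) conv is a strong converse, i.e., Φ (conv r) = (φ r)⁻¹ for every r : ι; (2) the involution axiom R7 holds for base relations, i.e., ⋃ s ∈ conv r, conv s = {r} for every r : ι; (3) the involution axiom R7 holds for all relations, i.e., (R˘)˘ = R for every R : Set ι. -/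
open Set

/-- Extension of a converse table to sets of base-relation names. -/
def setConv {ι : Type*} (conv : ι → Set ι) (R : Set ι) : Set ι :=
  ⋃ r ∈ R, conv r

/-- If `(x, y)` lies in `φ r` and its converse `(y, x)` lies in `φ s`, then `s ∈ conv r`. -/
theorem mem_conv_of_mem_of_swap_mem {α ι : Type*} {φ : ι → Set (α × α)} {conv : ι → Set ι}
    (hdisj : ∀ r s : ι, r ≠ s → Disjoint (φ r) (φ s))
    (hconv : ∀ r : ι, relConv (φ r) ⊆ interp φ (conv r))
    {r s : ι} {x y : α} (hr : (x, y) ∈ φ r) (hs : (y, x) ∈ φ s) : s ∈ conv r := by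
  obtain ⟨t, ht, hyx⟩ := mem_iUnion₂.mp (hconv r (show (y, x) ∈ relConv (φ r) from hr))
  have hst : s = t := by
    by_contra h
    exact Set.disjoint_left.mp (hdisj s t h) hs hyx
  exact hst ▸ ht

/-- The extended converse is an involution as soon as it is one on base relations. -/
theorem setConv_setConv {ι : Type*} {conv : ι → Set ι}
    (h : ∀ r : ι, (⋃ s ∈ conv r, conv s) = {r}) (R : Set ι) :
    setConv conv (setConv conv R) = R := by
  have h' : ∀ r t : ι, (∃ s ∈ conv r, t ∈ conv s) ↔ t = r := fun r t => by
    simpa using Set.ext_iff.mp (h r) t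
  ext t
  simp only [setConv, mem_iUnion, exists_prop]
  constructor
  · rintro ⟨s, ⟨r, hr, hs⟩, ht⟩
    exact (h' r t).mp ⟨s, hs, ht⟩ ▸ hr
  · intro ht
    obtain ⟨s, hs, hts⟩ := (h' t t).mpr rfl
    exact ⟨s, ⟨t, ht, hs⟩, hts⟩

theorem strong_converse_iff_R7 {α ι : Type*} (φ : ι → Set (α × α))
    (conv : ι → Set ι)
    (hne : ∀ r : ι, (φ r).Nonempty)
    (hdisj : ∀ r s : ι, r ≠ s → Disjoint (φ r) (φ s))
    (hexh : ⋃ r : ι, φ r = Set.univ)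
    (hconv : ∀ r : ι, relConv (φ r) ⊆ interp φ (conv r)) :
    ((∀ r : ι, interp φ (conv r) = relConv (φ r)) ↔
        (∀ r : ι, (⋃ s ∈ conv r, conv s) = {r})) ∧
    ((∀ r : ι, (⋃ s ∈ conv r, conv s) = {r}) ↔
        (∀ R : Set ι, setConv conv (setConv conv R) = R)) := by
  have hcover : ∀ p : α × α, ∃ r, p ∈ φ r := fun p =>
    mem_iUnion.mp (hexh ▸ mem_univ p)
  refine ⟨⟨fun h r => ?_, fun h r => ?_⟩, fun h R => setConv_setConv h R, fun h r => ?_⟩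
  · ext t
    simp only [mem_iUnion, exists_prop, mem_singleton_iff]
    constructor
    · rintro ⟨s, hs, ht⟩
      obtain ⟨⟨x, y⟩, hxy⟩ := hne t
      have hyx : (y, x) ∈ φ s := by
        have : (x, y) ∈ relConv (φ s) := h s ▸ mem_iUnion₂.mpr ⟨t, ht, hxy⟩
        exact this
      have hxy' : (x, y) ∈ φ r := by
        have : (y, x) ∈ relConv (φ r) := h r ▸ mem_iUnion₂.mpr ⟨s, hs, hyx⟩
        exact this
      by_contra htr
      exact Set.disjoint_left.mp (hdisj t r htr) hxy hxy'
    · rintro rfl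
      obtain ⟨⟨x, y⟩, hxy⟩ := hne t
      obtain ⟨s, hyx⟩ := hcover (y, x)
      exact ⟨s, mem_conv_of_mem_of_swap_mem hdisj hconv hxy hyx,
        mem_conv_of_mem_of_swap_mem hdisj hconv hyx hxy⟩
  · refine Subset.antisymm ?_ (hconv r)
    rintro ⟨x, y⟩ hp
    obtain ⟨s, hs, hxy⟩ := mem_iUnion₂.mp hp
    obtain ⟨t, hyx⟩ := hcover (y, x)
    have ht : t ∈ ⋃ s ∈ conv r, conv s :=
      mem_iUnion₂.mpr ⟨s, hs, mem_conv_of_mem_of_swap_mem hdisj hconv hxy hyx⟩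
    rw [h r, mem_singleton_iff] at ht
    subst ht
    exact hyx
  · simpa [setConv] using h {r}
end

section
/- Let A be a type equipped with a binary operation ⋄, a unary operation ˘, and a distinguished element e such that for all r s : A: r ⋄ e = r (right identity law R6); (r˘)˘ = r (R7); and (r ⋄ s)˘ = s˘ ⋄ r˘ (R9). Then the left identity law R6l holds: e ⋄ r = r for all r : A. -/
theorem left_identity_from_axioms {A : Type*}
    (comp : A → A → A) (conv : A → A) (e : A)
    (R6 : ∀ r : A, comp r e = r)
    (R7 : ∀ r : A, conv (conv r) = r)
    (R9 : ∀ r s : A, conv (comp r s) = comp (conv s) (conv r)) :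
    ∀ r : A, comp e r = r := by
  have conv_e : conv e = e := by
    have h := R9 (conv e) e
    rwa [R6, R7, R6, eq_comm] at h
  intro r
  have h := R9 (conv r) e
  rwa [R6, R7, conv_e, eq_comm] at h
end

section
/- Let φ : ι → Set (α × α) satisfy JEPD (each φ r is nonempty, the φ r are pairwise disjoint, and ⋃ r, φ r = Set.univ), let conv : ι → ι satisfy φ (conv r) = (φ r)⁻¹ for every r : ι (a partition scheme), and let comp : ι → ι → Set ι satisfy the membership criterion of weak composition: t ∈ comp r s ↔ φ t ∩ (φ r ○ φ s) ≠ ∅, for all r s t : ι. Then the Peircean law holds for base relations: for all r s t : ι, conv t ∈ comp r s ↔ conv r ∈ comp s t. -/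
open Set

theorem peircean_law_base {α ι : Type*} (φ : ι → Set (α × α))
    (conv : ι → ι) (comp : ι → ι → Set ι)
    (hne : ∀ r : ι, (φ r).Nonempty)
    (hdisj : ∀ r s : ι, r ≠ s → Disjoint (φ r) (φ s))
    (hexh : ⋃ r : ι, φ r = Set.univ)
    (hconv : ∀ r : ι, φ (conv r) = relConv (φ r))
    (hcomp : ∀ r s t : ι, t ∈ comp r s ↔ φ t ∩ relComp (φ r) (φ s) ≠ ∅) :
    ∀ r s t : ι, conv t ∈ comp r s ↔ conv r ∈ comp s t := by
  intro r s t
  rw [hcomp, hcomp, hconv, hconv, ← nonempty_iff_ne_empty, ← nonempty_iff_ne_empty]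
  constructor
  · rintro ⟨⟨x, z⟩, hzx, y, hxy, hyz⟩
    exact ⟨(y, x), hxy, z, hyz, hzx⟩
  · rintro ⟨⟨y, x⟩, hxy, z, hyz, hzx⟩
    exact ⟨(x, z), hzx, y, hxy, hyz⟩
end

section
/- Let φ : ι → Set (α × α) satisfy JEPD (each φ r is nonempty, the φ r are pairwise disjoint, and ⋃ r, φ r = Set.univ), let conv : ι → ι satisfy φ (conv r) = (φ r)⁻¹ for every r : ι (a partition scheme), and let comp : ι → ι → Set ι satisfy the membership criterion of weak composition: t ∈ comp r s ↔ φ t ∩ (φ r ○ φ s) ≠ ∅, for all r s t : ι. Then axiom R9 holds for base relations: for all r s : ι, the image of comp r s under conv equals comp (conv s) (conv r), i.e., conv '' (comp r s) = comp (conv s) (conv r). -/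
open Set

theorem relConv_relConv {α : Type*} (E : Set (α × α)) : relConv (relConv E) = E := rfl

theorem relConv_inter {α : Type*} (E F : Set (α × α)) :
    relConv (E ∩ F) = relConv E ∩ relConv F := rfl

theorem relConv_relComp {α : Type*} (E F : Set (α × α)) :
    relConv (relComp E F) = relComp (relConv F) (relConv E) := by
  ext p
  exact exists_congr fun _ => and_comm

theorem relConv_nonempty {α : Type*} {E : Set (α × α)} :
    (relConv E).Nonempty ↔ E.Nonempty :=
  ⟨fun ⟨p, hp⟩ => ⟨p.swap, hp⟩, fun ⟨p, hp⟩ => ⟨p.swap, hp⟩⟩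

theorem R9_base {α ι : Type*} (φ : ι → Set (α × α))
    (conv : ι → ι) (comp : ι → ι → Set ι)
    (hne : ∀ r : ι, (φ r).Nonempty)
    (hdisj : ∀ r s : ι, r ≠ s → Disjoint (φ r) (φ s))
    (hexh : ⋃ r : ι, φ r = Set.univ)
    (hconv : ∀ r : ι, φ (conv r) = relConv (φ r))
    (hcomp : ∀ r s t : ι, t ∈ comp r s ↔ φ t ∩ relComp (φ r) (φ s) ≠ ∅) :
    ∀ r s : ι, conv '' (comp r s) = comp (conv s) (conv r) := by
  intro r s
  have hinj : Function.Injective φ := fun a b hab => by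
    by_contra hne_ab
    have hd := hdisj a b hne_ab
    rw [← hab, disjoint_self] at hd
    exact (hne a).ne_empty hd
  have hinv : Function.Involutive conv := fun t =>
    hinj (by rw [hconv, hconv, relConv_relConv])
  have hmem (t : ι) : conv t ∈ comp (conv s) (conv r) ↔ t ∈ comp r s := by
    rw [hcomp, hcomp, hconv, hconv, hconv, ← relConv_relComp, ← relConv_inter,
      ← nonempty_iff_ne_empty, ← nonempty_iff_ne_empty, relConv_nonempty]
  ext t
  rw [hinv.image_eq_preimage_symm, mem_preimage, ← hmem, hinv t]
end

section
/- Let φ : ι → Set (α × α) satisfy JEPD (each φ r is nonempty, the φ r are pairwise disjoint, and ⋃ r, φ r = Set.univ), let e : ι satisfy φ e = {p : α × α | p.1 = p.2} (the identity relation), and let comp : ι → ι → Set ι satisfy the membership criterion of weak composition: t ∈ comp r s ↔ φ t ∩ (φ r ○ φ s) ≠ ∅, for all r s t : ι. Then the identity laws R6 and R6l hold for base relations: for every r : ι, comp r e = {r} and comp e r = {r}. -/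
open Set

theorem relComp_diagonal {α : Type*} (E : Set (α × α)) :
    relComp E {p | p.1 = p.2} = E := by
  ext ⟨x, z⟩
  simp [relComp]

theorem diagonal_relComp {α : Type*} (E : Set (α × α)) :
    relComp {p | p.1 = p.2} E = E := by
  ext ⟨x, z⟩
  simp [relComp]

theorem inter_ne_empty_iff_eq_of_disjoint {β ι : Type*} {φ : ι → Set β}
    (hne : ∀ r, (φ r).Nonempty) (hdisj : ∀ r s, r ≠ s → Disjoint (φ r) (φ s)) (t r : ι) :
    φ t ∩ φ r ≠ ∅ ↔ t = r := by
  constructor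
  · intro h
    by_contra htr
    exact h (hdisj t r htr).inter_eq
  · rintro rfl
    simpa using (hne t).ne_empty

theorem identity_laws_base {α ι : Type*} (φ : ι → Set (α × α))
    (e : ι) (comp : ι → ι → Set ι)
    (hne : ∀ r : ι, (φ r).Nonempty)
    (hdisj : ∀ r s : ι, r ≠ s → Disjoint (φ r) (φ s))
    (hexh : ⋃ r : ι, φ r = Set.univ)
    (hid : φ e = {p : α × α | p.1 = p.2})
    (hcomp : ∀ r s t : ι, t ∈ comp r s ↔ φ t ∩ relComp (φ r) (φ s) ≠ ∅) :
    ∀ r : ι, comp r e = {r} ∧ comp e r = {r} := by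
  intro r
  constructor
  · ext t
    rw [hcomp, hid, relComp_diagonal, inter_ne_empty_iff_eq_of_disjoint hne hdisj,
      mem_singleton_iff]
  · ext t
    rw [hcomp, hid, diagonal_relComp, inter_ne_empty_iff_eq_of_disjoint hne hdisj,
      mem_singleton_iff]
end

section
/- Let φ : ι → Set (α × α) satisfy JEPD (each φ r is nonempty, the φ r are pairwise disjoint, and ⋃ r, φ r = Set.univ), let conv : ι → ι satisfy φ (conv r) = (φ r)⁻¹ for every r : ι (a partition scheme), and let comp : ι → ι → Set ι satisfy the membership criterion of weak composition: t ∈ comp r s ↔ φ t ∩ (φ r ○ φ s) ≠ ∅, for all r s t : ι. Then the Tarski/de Morgan axiom R10 holds for base relations: for all r s : ι, s ∉ ⋃ t ∈ (comp r s)ᶜ, comp (conv r) t. -/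
open Set

theorem R10_base {α ι : Type*} (φ : ι → Set (α × α))
    (conv : ι → ι) (comp : ι → ι → Set ι)
    (hne : ∀ r : ι, (φ r).Nonempty)
    (hdisj : ∀ r s : ι, r ≠ s → Disjoint (φ r) (φ s))
    (hexh : ⋃ r : ι, φ r = Set.univ)
    (hconv : ∀ r : ι, φ (conv r) = relConv (φ r))
    (hcomp : ∀ r s t : ι, t ∈ comp r s ↔ φ t ∩ relComp (φ r) (φ s) ≠ ∅) :
    ∀ r s : ι, s ∉ ⋃ t ∈ (comp r s)ᶜ, comp (conv r) t := by
  intro r s hs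
  simp only [mem_iUnion, mem_compl_iff, exists_prop] at hs
  obtain ⟨t, ht, hst⟩ := hs
  obtain ⟨⟨x, z⟩, hxz, y, hxy, hyz⟩ := nonempty_iff_ne_empty.mpr ((hcomp _ _ _).mp hst)
  rw [hconv] at hxy
  exact ht ((hcomp _ _ _).mpr (nonempty_iff_ne_empty.mp ⟨(y, z), hyz, x, hxy, hxz⟩))
end

section
/- Let φ : ι → Set (α × α) satisfy JEPD (each φ r is nonempty, the φ r are pairwise disjoint, and ⋃ r, φ r = Set.univ), let every base relation be serial (for every r : ι and every x : α there is y : α with (x, y) ∈ φ r), and let comp : ι → ι → Set ι satisfy the membership criterion of weak composition: t ∈ comp r s ↔ φ t ∩ (φ r ○ φ s) ≠ ∅, for all r s t : ι. Then semi-associativity SA holds: for every R : Set ι, (R ⋄ 1) ⋄ 1 = R ⋄ 1, where 1 denotes (Set.univ : Set ι) and R ⋄ S = ⋃ r ∈ R, ⋃ s ∈ S, comp r s. -/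
open Set

/-- If `R` is nonempty, composing it with the universal relation yields every base relation. -/
theorem setComp_univ_of_nonempty {α ι : Type*} {φ : ι → Set (α × α)} {comp : ι → ι → Set ι}
    (hne : ∀ r : ι, (φ r).Nonempty) (hexh : ⋃ r : ι, φ r = Set.univ)
    (hserial : ∀ (r : ι) (x : α), ∃ y : α, (x, y) ∈ φ r)
    (hcomp : ∀ r s t : ι, t ∈ comp r s ↔ φ t ∩ relComp (φ r) (φ s) ≠ ∅)
    {R : Set ι} (hR : R.Nonempty) : setComp comp R Set.univ = Set.univ := by
  refine Set.eq_univ_of_forall fun t => ?_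
  obtain ⟨r, hr⟩ := hR
  obtain ⟨⟨x, z⟩, hxz⟩ := hne t
  obtain ⟨y, hxy⟩ := hserial r x
  obtain ⟨s, hyz⟩ := Set.mem_iUnion.1 (hexh ▸ Set.mem_univ (y, z))
  have ht : t ∈ comp r s :=
    (hcomp r s t).2 (Set.Nonempty.ne_empty ⟨(x, z), hxz, y, hxy, hyz⟩)
  exact Set.mem_biUnion hr (Set.mem_biUnion (Set.mem_univ s) ht)

theorem semi_associativity {α ι : Type*} (φ : ι → Set (α × α))
    (comp : ι → ι → Set ι)
    (hne : ∀ r : ι, (φ r).Nonempty)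
    (hdisj : ∀ r s : ι, r ≠ s → Disjoint (φ r) (φ s))
    (hexh : ⋃ r : ι, φ r = Set.univ)
    (hserial : ∀ (r : ι) (x : α), ∃ y : α, (x, y) ∈ φ r)
    (hcomp : ∀ r s t : ι, t ∈ comp r s ↔ φ t ∩ relComp (φ r) (φ s) ≠ ∅) :
    ∀ R : Set ι,
      setComp comp (setComp comp R Set.univ) Set.univ = setComp comp R Set.univ := by
  intro R
  rcases R.eq_empty_or_nonempty with rfl | hR
  · simp [setComp]
  · have hcompR := setComp_univ_of_nonempty hne hexh hserial hcomp hR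
    rw [hcompR]
    exact setComp_univ_of_nonempty hne hexh hserial hcomp (hR.mono (Set.subset_univ R))
end

section
/- Let φ : ι → Set (α × α) satisfy JEPD (each φ r is nonempty, the φ r are pairwise disjoint, and ⋃ r, φ r = Set.univ). Then for all r s : ι, the weak composition ⋂₀ {T : Set ι | Φ T ⊇ φ r ○ φ s} equals {t : ι | φ t ∩ (φ r ○ φ s) ≠ ∅}; that is, under JEPD, each weak-composition table entry consists of exactly those base relations whose interpretation intersects φ r ○ φ s. -/
open Set

theorem weak_composition_eq_intersecting {α ι : Type*} (φ : ι → Set (α × α))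
    (hne : ∀ r : ι, (φ r).Nonempty)
    (hdisj : ∀ r s : ι, r ≠ s → Disjoint (φ r) (φ s))
    (hexh : ⋃ r : ι, φ r = Set.univ) :
    ∀ r s : ι,
      ⋂₀ {T : Set ι | relComp (φ r) (φ s) ⊆ interp φ T} =
        {t : ι | φ t ∩ relComp (φ r) (φ s) ≠ ∅} := by
  intro r s
  ext t
  simp only [mem_sInter, mem_ofPred_eq, ← nonempty_iff_ne_empty]
  constructor
  · refine fun h => h {t | (φ t ∩ relComp (φ r) (φ s)).Nonempty} fun p hp => ?_
    obtain ⟨u, hu⟩ := mem_iUnion.1 (hexh ▸ mem_univ p)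
    exact mem_biUnion (show u ∈ {t | (φ t ∩ relComp (φ r) (φ s)).Nonempty} from ⟨p, hu, hp⟩) hu
  · rintro ⟨p, hpt, hp⟩ T hT
    obtain ⟨u, huT, hu⟩ := mem_iUnion₂.1 (hT hp)
    by_contra ht
    have htu : t ≠ u := fun h => ht (h ▸ huT)
    exact disjoint_left.1 (hdisj t u htu) hpt hu
end
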